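/- arXiv:1507.01968 — 2 statements merged into one kernel-verified Lean document; each statement's English description precedes it below -/
import Mathlib

section
/- Let G be a finite group and let U and V be subgroups of G. Then U and V are almost conjugate in G (for every g ∈ G, the number of elements of U conjugate to g in G equals the number of elements of V conjugate to g in G) if and only if the permutation characters of the actions of G on G/U and on G/V coincide, i.e., for every g ∈ G the number of left cosets xU ∈ G/U with g·xU = xU equals the number of left cosets yV ∈ G/V with g·yV = yV. -/
/-- The elements conjugating `g` into `U` are the union of the left cosets of `U` fixed by `g`. -/
theorem card_conj_mem_eq_card_mul_card_fixed {G : Type*} [Group G] (U : Subgroup G) (g : G) :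
    Nat.card {x : G | x⁻¹ * g * x ∈ U} = Nat.card U * Nat.card {x : G ⧸ U | g • x = x} := by
  rw [← Nat.card_prod,
    ← Nat.card_congr (QuotientGroup.preimageMkEquivSubgroupProdSet U {x : G ⧸ U | g • x = x})]
  congr 2
  ext x
  rw [Set.mem_ofPred_eq, Set.mem_preimage, Set.mem_ofPred_eq, MulAction.Quotient.smul_coe,
    eq_comm, QuotientGroup.eq, smul_eq_mul, mul_assoc]

/-- Each conjugate of `g` in `U` arises from `g` by as many conjugating elements as there are
elements commuting with `g`. -/
theorem card_conj_mem_eq_ncard_mul_card_commute {G : Type*} [Group G] [Finite G]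
    (U : Subgroup G) (g : G) :
    Nat.card {x : G | x⁻¹ * g * x ∈ U} =
      Set.ncard {x : G | x ∈ U ∧ IsConj x g} * Nat.card {z : G | Commute z g} := by
  classical
  have := Fintype.ofFinite G
  simp only [Nat.card_coe_set_eq, Set.ncard_eq_toFinset_card']
  rw [Finset.card_eq_sum_card_fiberwise (f := fun x => x⁻¹ * g * x)
    (t := {x : G | x ∈ U ∧ IsConj x g}.toFinset)]
  · refine Finset.sum_const_nat fun u hu => ?_
    obtain ⟨hu, hc⟩ : u ∈ U ∧ IsConj u g := by
      simpa only [Set.mem_toFinset, Set.mem_ofPred_eq] using hu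
    obtain ⟨c, rfl⟩ := isConj_iff.1 hc
    refine Finset.card_bij' (fun x _ => x * c⁻¹) (fun z _ => z * c) ?_ ?_ ?_ ?_
    · intro x hx
      have hx : x⁻¹ * (c * u * c⁻¹) * x = u := (Finset.mem_filter.1 hx).2
      rw [Set.mem_toFinset]
      change x * c⁻¹ * (c * u * c⁻¹) = c * u * c⁻¹ * (x * c⁻¹)
      calc x * c⁻¹ * (c * u * c⁻¹) = x * u * c⁻¹ := by group
        _ = x * (x⁻¹ * (c * u * c⁻¹) * x) * c⁻¹ := by rw [hx]
        _ = c * u * c⁻¹ * (x * c⁻¹) := by group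
    · intro z hz
      have hz : Commute z (c * u * c⁻¹) := by
        simpa only [Set.mem_toFinset, Set.mem_ofPred_eq] using hz
      have hzu : (z * c)⁻¹ * (c * u * c⁻¹) * (z * c) = u := by
        calc (z * c)⁻¹ * (c * u * c⁻¹) * (z * c) = c⁻¹ * z⁻¹ * (c * u * c⁻¹ * z) * c := by group
          _ = u := by rw [← hz.eq]; group
      refine Finset.mem_filter.2 ⟨Set.mem_toFinset.2 ?_, hzu⟩
      change (z * c)⁻¹ * (c * u * c⁻¹) * (z * c) ∈ U
      rwa [hzu]
    · exact fun x _ => inv_mul_cancel_right x c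
    · exact fun z _ => mul_inv_cancel_right z c
  · intro x hx
    have hx : x⁻¹ * g * x ∈ U := by simpa using hx
    exact Finset.mem_coe.2 (Set.mem_toFinset.2 ⟨hx, isConj_iff.2 ⟨x, by group⟩⟩)

/-- A subgroup is partitioned by the conjugacy classes of the ambient group. -/
theorem card_eq_of_forall_ncard_isConj_eq {G : Type*} [Group G] [Finite G] {U V : Subgroup G}
    (h : ∀ g : G, Set.ncard {x : G | x ∈ U ∧ IsConj x g} =
      Set.ncard {x : G | x ∈ V ∧ IsConj x g}) :
    Nat.card U = Nat.card V := by
  classical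
  have := Fintype.ofFinite G
  have key (W : Subgroup G) : Nat.card W =
      ∑ c : ConjClasses G, Set.ncard {x : G | x ∈ W ∧ ConjClasses.mk x = c} := by
    have hW : Nat.card W = (Finset.univ.filter (· ∈ W)).card := by
      rw [Nat.card_eq_fintype_card, Fintype.card_subtype]
    rw [hW, Finset.card_eq_sum_card_fiberwise (f := ConjClasses.mk) (t := Finset.univ)
      (fun _ _ => Finset.mem_coe.2 (Finset.mem_univ _))]
    refine Finset.sum_congr rfl fun c _ => ?_
    rw [Set.ncard_eq_toFinset_card']
    congr 1
    ext x
    simp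
  rw [key, key]
  refine Finset.sum_congr rfl fun c _ => ?_
  obtain ⟨g, rfl⟩ := ConjClasses.exists_rep c
  simpa only [ConjClasses.mk_eq_mk_iff_isConj] using h g

/-- Subgroups `U`, `V` of a finite group `G` are almost conjugate if and only if the
permutation characters of the left-multiplication actions of `G` on `G/U` and `G/V`
coincide. -/
theorem almostConj_iff_permChar_eq {G : Type*} [Group G] [Finite G]
    (U V : Subgroup G) :
    (∀ g : G, Set.ncard {x : G | x ∈ U ∧ IsConj x g} =
      Set.ncard {x : G | x ∈ V ∧ IsConj x g}) ↔
    (∀ g : G, Nat.card {x : G ⧸ U | g • x = x} = Nat.card {x : G ⧸ V | g • x = x}) := by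
  have key (W : Subgroup G) (g : G) := (card_conj_mem_eq_card_mul_card_fixed W g).symm.trans
    (card_conj_mem_eq_ncard_mul_card_commute W g)
  constructor
  · intro h g
    have hU := key U g
    rw [h g, ← key V g, card_eq_of_forall_ncard_isConj_eq h] at hU
    exact Nat.eq_of_mul_eq_mul_left Nat.card_pos hU
  · intro h g
    have hcard : Nat.card U = Nat.card V := by
      have h1 : Nat.card (G ⧸ U) = Nat.card (G ⧸ V) := by simpa using h 1
      have h2 := U.card_eq_card_quotient_mul_card_subgroup
      rw [V.card_eq_card_quotient_mul_card_subgroup, h1] at h2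
      exact (Nat.eq_of_mul_eq_mul_left Nat.card_pos h2).symm
    have hU := key U g
    rw [h g, hcard, key V g] at hU
    have : Nonempty {z : G | Commute z g} := ⟨⟨1, Commute.one_left g⟩⟩
    exact (Nat.eq_of_mul_eq_mul_right Nat.card_pos hU).symm
end

section
/- Let K be a field and V a finite-dimensional K-vector space with dim V ≥ 1. Fix a one-dimensional subspace x₀ of V and a hyperplane W₀ of V (a subspace with dim W₀ + 1 = dim V). Let L = {f ∈ GL(V) : f(x₀) = x₀} be the stabilizer of x₀ and L' = {f ∈ GL(V) : f(W₀) = W₀} the stabilizer of W₀. Then L and L' are elementwise conjugate in GL(V): every element of L is conjugate in GL(V) to an element of L', and every element of L' is conjugate in GL(V) to an element of L. -/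
/-- The stabilizer, in the group of linear automorphisms of `V`, of a subspace `W`. -/
def subspaceStabilizer (K : Type*) {V : Type*} [Field K] [AddCommGroup V] [Module K V]
    (W : Submodule K V) : Subgroup (V ≃ₗ[K] V) where
  carrier := {f : V ≃ₗ[K] V | W.map (f : V →ₗ[K] V) = W}
  one_mem' := by simp [Submodule.map_id]
  mul_mem' := by
    intro a b ha hb
    show W.map ((a * b : V ≃ₗ[K] V) : V →ₗ[K] V) = W
    have : ((a * b : V ≃ₗ[K] V) : V →ₗ[K] V) =
        ((a : V →ₗ[K] V).comp (b : V →ₗ[K] V)) := rfl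
    rw [this, Submodule.map_comp, hb, ha]
  inv_mem' := by
    intro a ha
    show W.map ((a⁻¹ : V ≃ₗ[K] V) : V →ₗ[K] V) = W
    conv_lhs => rw [← ha]
    rw [← Submodule.map_comp]
    have : ((a⁻¹ : V ≃ₗ[K] V) : V →ₗ[K] V).comp (a : V →ₗ[K] V) = LinearMap.id := by
      ext v
      exact a.symm_apply_apply v
    rw [this, Submodule.map_id]

open Module in
/-- Subspaces of equal dimension of a finite-dimensional space lie in one orbit of `GL(V)`. -/
theorem exists_linearEquiv_map_eq_of_finrank_eq {K V : Type*} [Field K] [AddCommGroup V]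
    [Module K V] [FiniteDimensional K V] (W W' : Submodule K V)
    (h : finrank K W = finrank K W') :
    ∃ e : V ≃ₗ[K] V, W.map (e : V →ₗ[K] V) = W' := by
  obtain ⟨e, he⟩ := Submodule.exists_linearEquiv_restrict_eq (LinearEquiv.ofFinrankEq W W' h)
  refine ⟨e, Submodule.eq_of_le_of_finrank_eq ?_ ((e.finrank_map_eq W).trans h)⟩
  rintro _ ⟨w, hw, rfl⟩
  exact he ⟨w, hw⟩ ▸ Submodule.coe_mem _

open Module in
/-- An endomorphism with an eigenvector has an invariant hyperplane. -/
theorem exists_hyperplane_map_le_of_apply_eq_smul {K V : Type*} [Field K] [AddCommGroup V]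
    [Module K V] [FiniteDimensional K V] (f : V →ₗ[K] V) {μ : K} {v : V} (hv : v ≠ 0)
    (h : f v = μ • v) :
    ∃ W : Submodule K V, finrank K W + 1 = finrank K V ∧ W.map f ≤ W := by
  have hr : LinearMap.range (f - μ • LinearMap.id) < ⊤ := by
    rw [lt_top_iff_ne_top, Ne, LinearMap.range_eq_top, ← LinearMap.injective_iff_surjective]
    intro hi
    exact hv (hi (by simp [h]))
  obtain ⟨φ, hφ, hle⟩ := Submodule.exists_le_ker_of_lt_top _ hr
  refine ⟨LinearMap.ker φ, Dual.finrank_ker_add_one_of_ne_zero hφ, ?_⟩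
  rintro _ ⟨w, hw, rfl⟩
  have h1 : φ ((f - μ • LinearMap.id : V →ₗ[K] V) w) = 0 := hle ⟨w, rfl⟩
  have h2 : φ w = 0 := hw
  simpa [h2] using h1

open Module in
/-- An endomorphism with an invariant hyperplane has an eigenvector. -/
theorem exists_apply_eq_smul_of_hyperplane_map_le {K V : Type*} [Field K] [AddCommGroup V]
    [Module K V] [FiniteDimensional K V] (f : V →ₗ[K] V) {W : Submodule K V}
    (hW : finrank K W + 1 = finrank K V) (h : W.map f ≤ W) :
    ∃ (c : K) (v : V), v ≠ 0 ∧ f v = c • v := by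
  have hlt : W < ⊤ := by
    rw [lt_top_iff_ne_top]
    rintro rfl
    simp at hW
  obtain ⟨φ, hφ, hle⟩ := Submodule.exists_le_ker_of_lt_top _ hlt
  have hker : W = LinearMap.ker φ := Submodule.eq_of_le_of_finrank_eq hle (by
    have := Dual.finrank_ker_add_one_of_ne_zero hφ
    omega)
  obtain ⟨u, hu⟩ := LinearMap.surjective hφ 1
  have hc (w : V) : φ (f w) = φ (f u) * φ w := by
    have hw : w - φ w • u ∈ W := by simp [hker, hu]
    have h1 : f (w - φ w • u) ∈ W := h ⟨_, hw, rfl⟩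
    rw [hker, LinearMap.mem_ker] at h1
    simp only [map_sub, map_smul, smul_eq_mul] at h1
    linear_combination h1
  have hni : ¬ Function.Injective (f - φ (f u) • LinearMap.id : V →ₗ[K] V) := by
    rw [LinearMap.injective_iff_surjective]
    intro hs
    obtain ⟨w, hw⟩ := hs u
    have := congrArg φ hw
    simp [hc w, hu] at this
  rw [← LinearMap.ker_eq_bot, Submodule.eq_bot_iff] at hni
  push Not at hni
  obtain ⟨v, hv, hv0⟩ := hni
  exact ⟨φ (f u), v, hv0, by simpa [sub_eq_zero] using hv⟩

open Module in
/-- An automorphism that maps a subspace into itself is conjugate to an element of the stabilizer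
of any subspace of the same dimension. -/
theorem exists_mem_subspaceStabilizer_isConj {K V : Type*} [Field K] [AddCommGroup V]
    [Module K V] [FiniteDimensional K V] (f : V ≃ₗ[K] V) (W W' : Submodule K V)
    (h : finrank K W = finrank K W') (hf : W.map (f : V →ₗ[K] V) ≤ W) :
    ∃ g ∈ subspaceStabilizer K W', IsConj f g := by
  obtain ⟨e, rfl⟩ := exists_linearEquiv_map_eq_of_finrank_eq W W' h
  refine ⟨e * f * e⁻¹, ?_, isConj_iff.2 ⟨e, rfl⟩⟩
  have hf' : W.map (f : V →ₗ[K] V) = W :=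
    Submodule.eq_of_le_of_finrank_eq hf (f.finrank_map_eq W)
  change (W.map (e : V →ₗ[K] V)).map ((e * f * e⁻¹ : V ≃ₗ[K] V) : V →ₗ[K] V) =
    W.map (e : V →ₗ[K] V)
  conv_rhs => rw [← hf']
  rw [← Submodule.map_comp, ← Submodule.map_comp]
  congr 1
  ext v
  exact congrArg (fun x => e (f x)) (e.symm_apply_apply v)

/-- Model example: in `GL(V)`, the stabilizer of a one-dimensional subspace `x₀` and the
stabilizer of a hyperplane `W₀` are elementwise conjugate subgroups. -/
theorem pointStab_elementwiseConj_hyperplaneStab {K V : Type*} [Field K]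
    [AddCommGroup V] [Module K V] [FiniteDimensional K V]
    (hV : 1 ≤ Module.finrank K V)
    (x₀ : Submodule K V) (hx₀ : Module.finrank K x₀ = 1)
    (W₀ : Submodule K V) (hW₀ : Module.finrank K W₀ + 1 = Module.finrank K V) :
    (∀ f ∈ subspaceStabilizer K x₀, ∃ g ∈ subspaceStabilizer K W₀, IsConj f g) ∧
    (∀ g ∈ subspaceStabilizer K W₀, ∃ f ∈ subspaceStabilizer K x₀, IsConj g f) := by
  constructor
  · intro f hf
    replace hf : x₀.map (f : V →ₗ[K] V) = x₀ := hf
    obtain ⟨⟨v, hvx⟩, hv, hspan⟩ := finrank_eq_one_iff'.1 hx₀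
    have hfv : f v ∈ x₀ := hf.le ⟨v, hvx, rfl⟩
    obtain ⟨μ, hμ⟩ := hspan ⟨f v, hfv⟩
    obtain ⟨W, hW, hfW⟩ := exists_hyperplane_map_le_of_apply_eq_smul (f : V →ₗ[K] V)
      (v := v) (μ := μ) (by simpa using hv) (congrArg Subtype.val hμ).symm
    exact exists_mem_subspaceStabilizer_isConj f W W₀ (by omega) hfW
  · intro g hg
    replace hg : W₀.map (g : V →ₗ[K] V) = W₀ := hg
    obtain ⟨c, v, hv, hgv⟩ :=
      exists_apply_eq_smul_of_hyperplane_map_le (g : V →ₗ[K] V) hW₀ hg.le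
    refine exists_mem_subspaceStabilizer_isConj g (K ∙ v) x₀
      (by rw [finrank_span_singleton hv, hx₀]) ?_
    rw [Submodule.map_span_le]
    rintro _ rfl
    exact Submodule.mem_span_singleton.2 ⟨c, hgv.symm⟩
end
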